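/- arXiv:1810.06663 — 2 statements merged into one kernel-verified Lean document; each statement's English description precedes it below -/
import Mathlib

section
/- Let 𝔤 be a finite-dimensional real Lie algebra equipped with a nondegenerate, symmetric, ad-invariant bilinear form ⟨·,·⟩ (i.e., ⟨[x,y],z⟩ = ⟨x,[y,z]⟩ for all x,y,z). Suppose 𝔤 = V ⊕ W and 𝔤 = V' ⊕ W' are two direct sum decompositions into isotropic Lie subalgebras (Manin triple splittings). Choose a basis (ξ_i) of V together with the dual basis (ξ^i) of W determined by ⟨ξ_i, ξ^j⟩ = δ_i^j, and likewise bases (ξ'_i) of V' and (ξ'^i) of W' with ⟨ξ'_i, ξ'^j⟩ = δ_i^j. Then the Lie-algebraic coefficient e = ∑_{i,j,k} ⟨ξ^k,[ξ_i,ξ_j]⟩·⟨ξ_k,[ξ^i,ξ^j]⟩ computed from (V,W) equals the coefficient e' = ∑_{i,j,k} ⟨ξ'^k,[ξ'_i,ξ'_j]⟩·⟨ξ'_k,[ξ'^i,ξ'^j]⟩ computed from (V',W'); in particular e does not depend on the choice of Manin triple splitting nor on the choice of dual bases. -/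
open Finset

/-- If `e`, `f` and `e'`, `f'` are two pairs of families reconstructing every vector by pairing
with `B`, then any bilinear map has the same contraction against both pairs. -/
lemma sum_dual_families_eq {R L M ι κ : Type*} [CommRing R] [AddCommGroup L] [Module R L]
    [AddCommGroup M] [Module R M] [Fintype ι] [Fintype κ]
    (B : LinearMap.BilinForm R L) (hsymm : ∀ x y, B x y = B y x)
    (e f : ι → L) (e' f' : κ → L)
    (hf : ∀ x, ∑ i, B (e i) x • f i = x) (he' : ∀ x, ∑ j, B (f' j) x • e' j = x)
    (F : L →ₗ[R] L →ₗ[R] M) :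
    ∑ i, F (e i) (f i) = ∑ j, F (e' j) (f' j) := by
  calc ∑ i, F (e i) (f i) = ∑ i, F (∑ j, B (f' j) (e i) • e' j) (f i) := by simp only [he']
    _ = ∑ j, F (e' j) (∑ i, B (e i) (f' j) • f i) := by
      simp only [map_sum, map_smul, LinearMap.sum_apply, LinearMap.smul_apply]
      rw [Finset.sum_comm]
      simp only [hsymm (f' _) (e _)]
    _ = ∑ j, F (e' j) (f' j) := by simp only [hf]

/-- The squared norm of the Cartan three-form, computed in a pair of dual families, does not
depend on that pair. -/
lemma sum_bracket_dual_families_eq {R L ι κ : Type*} [CommRing R] [LieRing L] [LieAlgebra R L]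
    [Fintype ι] [Fintype κ]
    (B : LinearMap.BilinForm R L) (hsymm : ∀ x y, B x y = B y x)
    (e f : ι → L) (e' f' : κ → L)
    (hf : ∀ x, ∑ i, B (e i) x • f i = x) (he' : ∀ x, ∑ j, B (f' j) x • e' j = x) :
    ∑ i, ∑ j, B ⁅e i, e j⁆ ⁅f i, f j⁆ = ∑ i, ∑ j, B ⁅e' i, e' j⁆ ⁅f' i, f' j⁆ := by
  let ad : L →ₗ[R] L →ₗ[R] L := (LieModule.toEnd R L L : L →ₗ[R] Module.End R L)
  have inner (x y : L) : ∑ j, B ⁅x, e j⁆ ⁅y, f j⁆ = ∑ j, B ⁅x, e' j⁆ ⁅y, f' j⁆ :=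
    sum_dual_families_eq B hsymm e f e' f' hf he' (B.compl₁₂ (ad x) (ad y))
  have outer (x y : L) : ∑ i, B ⁅e i, x⁆ ⁅f i, y⁆ = ∑ i, B ⁅e' i, x⁆ ⁅f' i, y⁆ :=
    sum_dual_families_eq B hsymm e f e' f' hf he' (B.compl₁₂ (ad.flip x) (ad.flip y))
  simp only [inner]
  rw [Finset.sum_comm]
  simp only [outer]
  rw [Finset.sum_comm]

/-- Dual bases of complementary isotropic subspaces reconstruct every vector. -/
lemma sum_smul_add_sum_smul_eq_of_isotropic {R L ι : Type*} [CommRing R] [AddCommGroup L]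
    [Module R L] [Fintype ι] [DecidableEq ι]
    (B : LinearMap.BilinForm R L) (hsymm : ∀ x y, B x y = B y x)
    (V W : Submodule R L) (hV : ∀ x ∈ V, ∀ y ∈ V, B x y = 0) (hW : ∀ x ∈ W, ∀ y ∈ W, B x y = 0)
    (hsup : V ⊔ W = ⊤) (ξ ξd : ι → L)
    (hξ : Submodule.span R (Set.range ξ) = V) (hξd : Submodule.span R (Set.range ξd) = W)
    (hdual : ∀ i j, B (ξ i) (ξd j) = if i = j then 1 else 0) (x : L) :
    ∑ i, B (ξd i) x • ξ i + ∑ i, B (ξ i) x • ξd i = x := by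
  have hξV (i) : ξ i ∈ V := hξ ▸ Submodule.subset_span ⟨i, rfl⟩
  have hξdW (i) : ξd i ∈ W := hξd ▸ Submodule.subset_span ⟨i, rfl⟩
  have hVV (i j) : B (ξ i) (ξ j) = 0 := hV _ (hξV i) _ (hξV j)
  have hWW (i j) : B (ξd i) (ξd j) = 0 := hW _ (hξdW i) _ (hξdW j)
  have hdual' (i j) : B (ξd i) (ξ j) = if j = i then 1 else 0 := by rw [hsymm, hdual]
  let T : L →ₗ[R] L := ∑ i, (B (ξd i)).smulRight (ξ i) + ∑ i, (B (ξ i)).smulRight (ξd i)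
  have hT (y) : T y = ∑ i, B (ξd i) y • ξ i + ∑ i, B (ξ i) y • ξd i := by simp [T]
  have hTV : ∀ y ∈ V, T y = y := by
    rw [← hξ]
    intro y hy
    refine LinearMap.eqOn_span (f := T) (g := LinearMap.id) ?_ hy
    rintro _ ⟨j, rfl⟩
    simp [hT, hVV, hdual']
  have hTW : ∀ y ∈ W, T y = y := by
    rw [← hξd]
    intro y hy
    refine LinearMap.eqOn_span (f := T) (g := LinearMap.id) ?_ hy
    rintro _ ⟨j, rfl⟩
    simp [hT, hWW, hdual]
  obtain ⟨v, hv, w, hw, rfl⟩ := Submodule.mem_sup.mp (hsup ▸ Submodule.mem_top (x := x))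
  rw [← hT, map_add, hTV v hv, hTW w hw]

/-- The squared norm of the Cartan three-form is six times the theta-graph coefficient of any
Manin triple splitting. -/
lemma six_mul_theta_coefficient_eq {R L ι : Type*} [CommRing R] [LieRing L] [LieAlgebra R L]
    [Fintype ι]
    (B : LinearMap.BilinForm R L) (hsymm : ∀ x y, B x y = B y x)
    (hadinv : ∀ x y z : L, B ⁅x, y⁆ z = B x ⁅y, z⁆)
    (V : LieSubalgebra R L) (hV : ∀ x ∈ V, ∀ y ∈ V, B x y = 0)
    (ξ ξd : ι → L) (hξV : ∀ i, ξ i ∈ V)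
    (hrec : ∀ x, ∑ i, B (ξd i) x • ξ i + ∑ i, B (ξ i) x • ξd i = x) :
    6 * ∑ i, ∑ j, ∑ k, B (ξd k) ⁅ξ i, ξ j⁆ * B (ξ k) ⁅ξd i, ξd j⁆ =
      ∑ a, ∑ b, B ⁅Sum.elim ξ ξd a, Sum.elim ξ ξd b⁆ ⁅Sum.elim ξd ξ a, Sum.elim ξd ξ b⁆ := by
  have hcyc (x y z : L) : B x ⁅y, z⁆ = B z ⁅x, y⁆ := by rw [← hadinv, hsymm]
  have hexp (x y : L) :
      B x y = ∑ k, B (ξd k) x * B (ξ k) y + ∑ k, B (ξ k) x * B (ξd k) y := by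
    conv_lhs => rw [← hrec x]
    simp
  have hVVV (i j k) : B (ξ k) ⁅ξ i, ξ j⁆ = 0 := hV _ (hξV k) _ (V.lie_mem (hξV i) (hξV j))
  have hVVWW : ∑ i, ∑ j, B ⁅ξ i, ξ j⁆ ⁅ξd i, ξd j⁆ =
      ∑ i, ∑ j, ∑ k, B (ξd k) ⁅ξ i, ξ j⁆ * B (ξ k) ⁅ξd i, ξd j⁆ := by
    refine Finset.sum_congr rfl fun i _ => Finset.sum_congr rfl fun j _ => ?_
    rw [hexp]
    simp [hVVV]
  have hVWWV : ∑ i, ∑ j, B ⁅ξ i, ξd j⁆ ⁅ξd i, ξ j⁆ =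
      2 * ∑ i, ∑ j, ∑ k, B (ξd k) ⁅ξ i, ξ j⁆ * B (ξ k) ⁅ξd i, ξd j⁆ := by
    have hfirst : ∑ i, ∑ j, ∑ k, B (ξd k) ⁅ξ i, ξd j⁆ * B (ξ k) ⁅ξd i, ξ j⁆ =
        ∑ i, ∑ j, ∑ k, B (ξd k) ⁅ξ i, ξ j⁆ * B (ξ k) ⁅ξd i, ξd j⁆ := by
      rw [Finset.sum_comm]
      refine Finset.sum_congr rfl fun j _ => ?_
      rw [Finset.sum_comm]
      refine Finset.sum_congr rfl fun k _ => Finset.sum_congr rfl fun i _ => ?_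
      rw [← hcyc (ξ i) (ξd j) (ξd k), hcyc (ξ k) (ξd i) (ξ j), hcyc (ξ j) (ξ k) (ξd i), mul_comm]
    have hsecond : ∑ i, ∑ j, ∑ k, B (ξ k) ⁅ξ i, ξd j⁆ * B (ξd k) ⁅ξd i, ξ j⁆ =
        ∑ i, ∑ j, ∑ k, B (ξd k) ⁅ξ i, ξ j⁆ * B (ξ k) ⁅ξd i, ξd j⁆ := by
      simp only [Finset.sum_comm (f := fun j k => B (ξ k) ⁅ξ _, ξd j⁆ * B (ξd k) ⁅ξd _, ξ j⁆)]
      rw [Finset.sum_comm]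
      refine Finset.sum_congr rfl fun k _ => Finset.sum_congr rfl fun i _ =>
        Finset.sum_congr rfl fun j _ => ?_
      rw [hcyc (ξ k), hcyc (ξd k)]
    simp only [hexp ⁅ξ _, ξd _⁆, Finset.sum_add_distrib, hfirst, hsecond]
    ring
  have hWVVW : ∑ i, ∑ j, B ⁅ξd i, ξ j⁆ ⁅ξ i, ξd j⁆ = ∑ i, ∑ j, B ⁅ξ i, ξd j⁆ ⁅ξd i, ξ j⁆ := by
    simp only [hsymm ⁅ξd _, ξ _⁆]
  have hWWVV : ∑ i, ∑ j, B ⁅ξd i, ξd j⁆ ⁅ξ i, ξ j⁆ = ∑ i, ∑ j, B ⁅ξ i, ξ j⁆ ⁅ξd i, ξd j⁆ := by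
    simp only [hsymm ⁅ξd _, ξd _⁆]
  simp only [Fintype.sum_sum_type, Sum.elim_inl, Sum.elim_inr, Finset.sum_add_distrib, hWVVW,
    hWWVV, hVWWV, hVVWW]
  ring

/-- Independence of the theta-graph Lie algebra coefficient `e(𝔤)` of the choice of
Manin triple splitting.  Let `𝔤` be a finite-dimensional real Lie algebra with a
nondegenerate symmetric ad-invariant bilinear form `B`.  Given two decompositions
`𝔤 = V ⊕ W` and `𝔤 = V' ⊕ W'` into isotropic Lie subalgebras, bases `ξ` of `V` and `ξ'`
of `V'`, together with the dual bases `ξd` of `W` and `ξ'd` of `W'`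
(`B (ξ i) (ξd j) = δ_i^j`), the coefficients
`e = ∑_{i,j,k} B(ξd k, ⁅ξ i, ξ j⁆) · B(ξ k, ⁅ξd i, ξd j⁆)` computed from the two
splittings coincide. -/
theorem theta_coefficient_independent_of_manin_splitting
    {L : Type*} [LieRing L] [LieAlgebra ℝ L] [Module.Finite ℝ L]
    (B : LinearMap.BilinForm ℝ L)
    (hsymm : ∀ x y : L, B x y = B y x)
    (hnondeg : B.Nondegenerate)
    (hadinv : ∀ x y z : L, B ⁅x, y⁆ z = B x ⁅y, z⁆)
    (V W V' W' : LieSubalgebra ℝ L)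
    (hVisot : ∀ x ∈ V, ∀ y ∈ V, B x y = 0)
    (hWisot : ∀ x ∈ W, ∀ y ∈ W, B x y = 0)
    (hV'isot : ∀ x ∈ V', ∀ y ∈ V', B x y = 0)
    (hW'isot : ∀ x ∈ W', ∀ y ∈ W', B x y = 0)
    (hcompl : IsCompl V.toSubmodule W.toSubmodule)
    (hcompl' : IsCompl V'.toSubmodule W'.toSubmodule)
    {ι κ : Type*} [Fintype ι] [DecidableEq ι] [Fintype κ] [DecidableEq κ]
    (ξ : ι → L) (ξd : ι → L) (ξ' : κ → L) (ξ'd : κ → L)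
    (hξV : ∀ i, ξ i ∈ V) (hξdW : ∀ i, ξd i ∈ W)
    (hξ'V' : ∀ i, ξ' i ∈ V') (hξ'dW' : ∀ i, ξ'd i ∈ W')
    (hξbasis : LinearIndependent ℝ ξ ∧ Submodule.span ℝ (Set.range ξ) = V.toSubmodule)
    (hξdbasis : LinearIndependent ℝ ξd ∧ Submodule.span ℝ (Set.range ξd) = W.toSubmodule)
    (hξ'basis : LinearIndependent ℝ ξ' ∧ Submodule.span ℝ (Set.range ξ') = V'.toSubmodule)
    (hξ'dbasis : LinearIndependent ℝ ξ'd ∧ Submodule.span ℝ (Set.range ξ'd) = W'.toSubmodule)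
    (hdual : ∀ i j, B (ξ i) (ξd j) = if i = j then (1:ℝ) else 0)
    (hdual' : ∀ i j, B (ξ' i) (ξ'd j) = if i = j then (1:ℝ) else 0) :
    ∑ i : ι, ∑ j : ι, ∑ k : ι, B (ξd k) ⁅ξ i, ξ j⁆ * B (ξ k) ⁅ξd i, ξd j⁆
      = ∑ i : κ, ∑ j : κ, ∑ k : κ, B (ξ'd k) ⁅ξ' i, ξ' j⁆ * B (ξ' k) ⁅ξ'd i, ξ'd j⁆ := by
  have hrec := sum_smul_add_sum_smul_eq_of_isotropic B hsymm V.toSubmodule W.toSubmodule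
    hVisot hWisot hcompl.sup_eq_top ξ ξd hξbasis.2 hξdbasis.2 hdual
  have hrec' := sum_smul_add_sum_smul_eq_of_isotropic B hsymm V'.toSubmodule W'.toSubmodule
    hV'isot hW'isot hcompl'.sup_eq_top ξ' ξ'd hξ'basis.2 hξ'dbasis.2 hdual'
  have h6 : (6 : ℝ) ≠ 0 := by norm_num
  apply mul_left_cancel₀ h6
  rw [six_mul_theta_coefficient_eq B hsymm hadinv V hVisot ξ ξd hξV hrec,
    six_mul_theta_coefficient_eq B hsymm hadinv V' hV'isot ξ' ξ'd hξ'V' hrec']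
  refine sum_bracket_dual_families_eq B hsymm _ _ _ _ (fun x => ?_) (fun x => ?_)
  · simpa [add_comm] using hrec x
  · simpa using hrec' x
end

section
/- There exists a 4-dimensional real Lie algebra 𝔡 carrying a nondegenerate, symmetric, ad-invariant bilinear form ⟨·,·⟩ and a Manin triple splitting 𝔡 = V ⊕ W in which both V and W are 2-dimensional non-abelian Lie subalgebras (namely the Drinfeld double of the Lie bialgebra 𝔤 = ℝx ⊕ ℝy with bracket [x,y] = y and dual bracket [x*,y*] = y*), such that the Lie-algebraic coefficient e(𝔡), computed from dual bases (ξ_i) of V and (ξ^i) of W with ⟨ξ_i,ξ^j⟩ = δ_i^j as e(𝔡) = ∑_{i,j,k} ⟨ξ^k,[ξ_i,ξ_j]⟩·⟨ξ_k,[ξ^i,ξ^j]⟩, equals 2. -/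
open Finset

/-- The data of a 4-dimensional quadratic real Lie algebra `𝔡` with a Manin triple
splitting `𝔡 = V ⊕ W` into two 2-dimensional non-abelian isotropic Lie subalgebras,
together with dual bases `ξ` of `V` and `ξd` of `W` satisfying `B (ξ i) (ξd j) = δ_i^j`
(as for the Drinfeld double of the 2-dimensional non-abelian Lie bialgebra). -/
structure QuadManinTripleDim4 where
  /-- the underlying carrier of the Lie algebra `𝔡` -/
  carrier : Type
  [lieRing : LieRing carrier]
  [lieAlgebra : LieAlgebra ℝ carrier]
  /-- the invariant bilinear form `⟨·,·⟩` -/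
  B : LinearMap.BilinForm ℝ carrier
  symm : ∀ x y : carrier, B x y = B y x
  nondeg : B.Nondegenerate
  adInvariant : ∀ x y z : carrier, B ⁅x, y⁆ z = B x ⁅y, z⁆
  /-- `𝔡` is 4-dimensional -/
  dim4 : Module.finrank ℝ carrier = 4
  /-- the first isotropic Lie subalgebra -/
  V : LieSubalgebra ℝ carrier
  /-- the second isotropic Lie subalgebra -/
  W : LieSubalgebra ℝ carrier
  Visotropic : ∀ x ∈ V, ∀ y ∈ V, B x y = 0
  Wisotropic : ∀ x ∈ W, ∀ y ∈ W, B x y = 0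
  compl : IsCompl V.toSubmodule W.toSubmodule
  Vdim2 : Module.finrank ℝ V.toSubmodule = 2
  Wdim2 : Module.finrank ℝ W.toSubmodule = 2
  VnonAbelian : ∃ x ∈ V, ∃ y ∈ V, ⁅x, y⁆ ≠ (0 : carrier)
  WnonAbelian : ∃ x ∈ W, ∃ y ∈ W, ⁅x, y⁆ ≠ (0 : carrier)
  /-- a basis of `V` -/
  ξ : Fin 2 → carrier
  /-- the dual basis of `W` -/
  ξd : Fin 2 → carrier
  ξmemV : ∀ i, ξ i ∈ V
  ξdmemW : ∀ i, ξd i ∈ W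
  ξbasis : LinearIndependent ℝ ξ ∧ Submodule.span ℝ (Set.range ξ) = V.toSubmodule
  ξdbasis : LinearIndependent ℝ ξd ∧ Submodule.span ℝ (Set.range ξd) = W.toSubmodule
  dual : ∀ i j, B (ξ i) (ξd j) = if i = j then (1 : ℝ) else 0

attribute [instance] QuadManinTripleDim4.lieRing QuadManinTripleDim4.lieAlgebra

section GLTwo

attribute [local instance] LieRing.ofAssociativeRing

/-- The polarization `tr X tr Y - tr (X Y)` of `2 det` on `2 × 2` matrices. It makes `𝔤𝔩₂(ℝ)` the
Drinfeld double of the non-abelian `2`-dimensional Lie bialgebra. -/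
def detForm : LinearMap.BilinForm ℝ (Matrix (Fin 2) (Fin 2) ℝ) :=
  LinearMap.mk₂ ℝ (fun X Y => X.trace * Y.trace - (X * Y).trace)
    (fun X X' Y => by simp only [Matrix.trace_add, add_mul]; ring)
    (fun c X Y => by simp only [Matrix.trace_smul, smul_mul_assoc, smul_eq_mul]; ring)
    (fun X Y Y' => by simp only [Matrix.trace_add, mul_add]; ring)
    (fun c X Y => by simp only [Matrix.trace_smul, mul_smul_comm, smul_eq_mul]; ring)

lemma detForm_apply (X Y : Matrix (Fin 2) (Fin 2) ℝ) :
    detForm X Y = X 0 0 * Y 1 1 + X 1 1 * Y 0 0 - X 0 1 * Y 1 0 - X 1 0 * Y 0 1 := by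
  simp only [detForm, LinearMap.mk₂_apply, Matrix.trace_fin_two, Matrix.mul_apply,
    Fin.sum_univ_two]
  ring

lemma detForm_symm (X Y : Matrix (Fin 2) (Fin 2) ℝ) : detForm X Y = detForm Y X := by
  simp only [detForm_apply]
  ring

lemma detForm_lie (X Y Z : Matrix (Fin 2) (Fin 2) ℝ) :
    detForm ⁅X, Y⁆ Z = detForm X ⁅Y, Z⁆ := by
  simp only [detForm_apply, Ring.lie_def, Matrix.sub_apply, Matrix.mul_apply, Fin.sum_univ_two]
  ring

lemma detForm_nondegenerate : detForm.Nondegenerate := by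
  have hsep : detForm.SeparatingLeft := by
    intro X hX
    have h00 := hX !![0, 0; 0, 1]
    have h11 := hX !![1, 0; 0, 0]
    have h01 := hX !![0, 0; 1, 0]
    have h10 := hX !![0, 1; 0, 0]
    simp [detForm_apply] at h00 h11 h01 h10
    ext i j
    fin_cases i <;> fin_cases j <;> simp [*]
  exact ⟨hsep, fun Y hY => hsep Y fun X => detForm_symm Y X ▸ hY X⟩

/-- The Lie subalgebra of `2 × 2` matrices supported on the row `r`. -/
def rowSubalgebra (r : Fin 2) : LieSubalgebra ℝ (Matrix (Fin 2) (Fin 2) ℝ) where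
  carrier := {X | ∀ i, i ≠ r → ∀ j, X i j = 0}
  add_mem' hX hY i hi j := by simp [hX i hi j, hY i hi j]
  zero_mem' _ _ _ := rfl
  smul_mem' c X hX i hi j := by simp [hX i hi j]
  lie_mem' hX hY i hi j := by simp [Ring.lie_def, Matrix.mul_apply, hX i hi, hY i hi]

lemma mem_rowSubalgebra {r : Fin 2} {X : Matrix (Fin 2) (Fin 2) ℝ} :
    X ∈ rowSubalgebra r ↔ ∀ i, i ≠ r → ∀ j, X i j = 0 := Iff.rfl

lemma mem_rowSubalgebra_zero {X : Matrix (Fin 2) (Fin 2) ℝ} :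
    X ∈ rowSubalgebra 0 ↔ X 1 0 = 0 ∧ X 1 1 = 0 := by
  simp [mem_rowSubalgebra, Fin.forall_fin_two]

lemma mem_rowSubalgebra_one {X : Matrix (Fin 2) (Fin 2) ℝ} :
    X ∈ rowSubalgebra 1 ↔ X 0 0 = 0 ∧ X 0 1 = 0 := by
  simp [mem_rowSubalgebra, Fin.forall_fin_two]

lemma isCompl_rowSubalgebra :
    IsCompl (rowSubalgebra 0).toSubmodule (rowSubalgebra 1).toSubmodule := by
  refine ⟨Submodule.disjoint_def.2 fun X hV hW => ?_, ?_⟩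
  · rw [LieSubalgebra.mem_toSubmodule, mem_rowSubalgebra_zero] at hV
    rw [LieSubalgebra.mem_toSubmodule, mem_rowSubalgebra_one] at hW
    ext i j
    fin_cases i <;> fin_cases j <;> simp [hV, hW]
  · refine codisjoint_iff.2 (Submodule.eq_top_iff'.2 fun X => Submodule.mem_sup.2
      ⟨!![X 0 0, X 0 1; 0, 0], ?_, !![0, 0; X 1 0, X 1 1], ?_, ?_⟩)
    · simp [mem_rowSubalgebra_zero]
    · simp [mem_rowSubalgebra_one]
    · ext i j
      fin_cases i <;> fin_cases j <;> simp

/-- The basis `E₀₀, E₀₁` of the matrices supported on the first row. -/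
def firstRowBasis : Fin 2 → Matrix (Fin 2) (Fin 2) ℝ :=
  ![!![1, 0; 0, 0], !![0, 1; 0, 0]]

/-- The basis `E₁₁, -E₁₀` of the matrices supported on the second row, dual to `firstRowBasis`
for `detForm`. -/
def secondRowBasis : Fin 2 → Matrix (Fin 2) (Fin 2) ℝ :=
  ![!![0, 0; 0, 1], !![0, 0; -1, 0]]

lemma linearIndependent_firstRowBasis : LinearIndependent ℝ firstRowBasis := by
  refine LinearIndependent.pair_iff.2 fun s t h => ?_
  have h0 := congrFun₂ h 0 0
  have h1 := congrFun₂ h 0 1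
  simp at h0 h1
  exact ⟨h0, h1⟩

lemma linearIndependent_secondRowBasis : LinearIndependent ℝ secondRowBasis := by
  refine LinearIndependent.pair_iff.2 fun s t h => ?_
  have h0 := congrFun₂ h 1 1
  have h1 := congrFun₂ h 1 0
  simp at h0 h1
  exact ⟨h0, h1⟩

lemma span_firstRowBasis :
    Submodule.span ℝ (Set.range firstRowBasis) = (rowSubalgebra 0).toSubmodule := by
  ext X
  rw [firstRowBasis, Matrix.range_cons_cons_empty, Submodule.mem_span_pair,
    LieSubalgebra.mem_toSubmodule, mem_rowSubalgebra_zero]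
  constructor
  · rintro ⟨s, t, rfl⟩
    simp
  · rintro ⟨h0, h1⟩
    refine ⟨X 0 0, X 0 1, ?_⟩
    ext i j
    fin_cases i <;> fin_cases j <;> simp [h0, h1]

lemma span_secondRowBasis :
    Submodule.span ℝ (Set.range secondRowBasis) = (rowSubalgebra 1).toSubmodule := by
  ext X
  rw [secondRowBasis, Matrix.range_cons_cons_empty, Submodule.mem_span_pair,
    LieSubalgebra.mem_toSubmodule, mem_rowSubalgebra_one]
  constructor
  · rintro ⟨s, t, rfl⟩
    simp
  · rintro ⟨h0, h1⟩
    refine ⟨X 1 1, -X 1 0, ?_⟩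
    ext i j
    fin_cases i <;> fin_cases j <;> simp [h0, h1]

/-- The Manin triple on `𝔤𝔩₂(ℝ)` given by its two rows. -/
def glTwoManinTriple : QuadManinTripleDim4 where
  carrier := Matrix (Fin 2) (Fin 2) ℝ
  B := detForm
  symm := detForm_symm
  nondeg := detForm_nondegenerate
  adInvariant := detForm_lie
  dim4 := by simp [Module.finrank_matrix]
  V := rowSubalgebra 0
  W := rowSubalgebra 1
  Visotropic X hX Y hY := by
    rw [mem_rowSubalgebra_zero] at hX hY
    simp [detForm_apply, hX, hY]
  Wisotropic X hX Y hY := by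
    rw [mem_rowSubalgebra_one] at hX hY
    simp [detForm_apply, hX, hY]
  compl := isCompl_rowSubalgebra
  Vdim2 := by
    rw [← span_firstRowBasis, finrank_span_eq_card linearIndependent_firstRowBasis,
      Fintype.card_fin]
  Wdim2 := by
    rw [← span_secondRowBasis, finrank_span_eq_card linearIndependent_secondRowBasis,
      Fintype.card_fin]
  VnonAbelian := by
    refine ⟨!![1, 0; 0, 0], by simp [mem_rowSubalgebra_zero],
      !![0, 1; 0, 0], by simp [mem_rowSubalgebra_zero], fun h => ?_⟩
    simpa [Ring.lie_def] using congrFun₂ h 0 1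
  WnonAbelian := by
    refine ⟨!![0, 0; 0, 1], by simp [mem_rowSubalgebra_one],
      !![0, 0; 1, 0], by simp [mem_rowSubalgebra_one], fun h => ?_⟩
    simpa [Ring.lie_def] using congrFun₂ h 1 0
  ξ := firstRowBasis
  ξd := secondRowBasis
  ξmemV i := by fin_cases i <;> simp [mem_rowSubalgebra_zero, firstRowBasis]
  ξdmemW i := by fin_cases i <;> simp [mem_rowSubalgebra_one, secondRowBasis]
  ξbasis := ⟨linearIndependent_firstRowBasis, span_firstRowBasis⟩
  ξdbasis := ⟨linearIndependent_secondRowBasis, span_secondRowBasis⟩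
  dual i j := by
    fin_cases i <;> fin_cases j <;> simp [detForm_apply, firstRowBasis, secondRowBasis]

lemma theta_firstRowBasis_secondRowBasis :
    ∑ i, ∑ j, ∑ k, detForm (secondRowBasis k) ⁅firstRowBasis i, firstRowBasis j⁆ *
      detForm (firstRowBasis k) ⁅secondRowBasis i, secondRowBasis j⁆ = 2 := by
  simp [Fin.sum_univ_two, detForm_apply, firstRowBasis, secondRowBasis, Ring.lie_def]
  norm_num

end GLTwo

/-- There is a 4-dimensional quadratic real Lie algebra with a Manin triple splitting into
2-dimensional non-abelian subalgebras (the Drinfeld double of `ℝx ⊕ ℝy`, `[x,y] = y`) whose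
theta-graph coefficient `e(𝔡) = ∑_{i,j,k} ⟨ξ^k,[ξ_i,ξ_j]⟩·⟨ξ_k,[ξ^i,ξ^j]⟩` equals `2`. -/
theorem exists_quadManinTripleDim4_theta_coefficient_eq_two :
    ∃ D : QuadManinTripleDim4,
      ∑ i : Fin 2, ∑ j : Fin 2, ∑ k : Fin 2,
        D.B (D.ξd k) ⁅D.ξ i, D.ξ j⁆ * D.B (D.ξ k) ⁅D.ξd i, D.ξd j⁆ = 2 :=
  ⟨glTwoManinTriple, theta_firstRowBasis_secondRowBasis⟩
end
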